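/- arXiv:2303.04795 — 7 statements merged into one kernel-verified Lean document; each statement's English description precedes it below -/
import Mathlib

section
/- Let 𝔸 be a groupoid and K a kit on 𝔸. Then K = K^⊥⊥ if and only if both of the following hold: (1) for every object a, K(a) = {H ≤ End(a) | H ⊆ ⋃K(a)} (where ⋃K(a) denotes the union of all subgroups in K(a)); and (2) K is saturated, i.e., for every object a and every α ∈ End(a), if for all n ∈ ℕ either α^n = id or there exists m ∈ ℕ with α^{nm} ≠ id and α^{nm} ∈ ⋃K(a), then α ∈ ⋃K(a). -/
open CategoryTheory

universe v u

/-- Conjugation of endomorphisms along a morphism `α : a' ⟶ a` in a groupoid,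
as a group homomorphism `End a →* End a'`. -/
def conjHom {A : Type u} [Groupoid.{v} A] {a a' : A} (α : a' ⟶ a) :
    CategoryTheory.End a →* CategoryTheory.End a' where
  toFun g := α ≫ g ≫ Groupoid.inv α
  map_one' := by
    show α ≫ 𝟙 a ≫ Groupoid.inv α = 𝟙 a'
    simp
  map_mul' g h := by
    show α ≫ (h ≫ g) ≫ Groupoid.inv α =
      (α ≫ h ≫ Groupoid.inv α) ≫ (α ≫ g ≫ Groupoid.inv α)
    simp

/-- The conjugate subgroup `α⁻¹ ∘ G ∘ α ≤ End a'` of `G ≤ End a` along `α : a' ⟶ a`. -/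
def conjSub {A : Type u} [Groupoid.{v} A] {a a' : A} (α : a' ⟶ a)
    (G : Subgroup (CategoryTheory.End a)) : Subgroup (CategoryTheory.End a') :=
  G.map (conjHom α)

/-- A kit on a groupoid: a conjugation-closed family of sets of subgroups of vertex groups. -/
structure Kit (A : Type u) [Groupoid.{v} A] where
  K : ∀ a : A, Set (Subgroup (CategoryTheory.End a))
  conj_mem : ∀ {a a' : A} (α : a' ⟶ a), ∀ G ∈ K a, conjSub α G ∈ K a'

/-- The orthogonal of a set of subgroups: subgroups meeting every member trivially. -/
def orthSet {G : Type*} [Group G] (S : Set (Subgroup G)) : Set (Subgroup G) :=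
  {H | ∀ J ∈ S, H ⊓ J = ⊥}

/-- A kit is Boolean when each component is closed under double orthogonality. -/
def Kit.IsBoolean {A : Type u} [Groupoid.{v} A] (K : Kit A) : Prop :=
  ∀ a : A, K.K a = orthSet (orthSet (K.K a))

/-- The union of all the subgroups in a set of subgroups. -/
def unionOf {G : Type*} [Group G] (S : Set (Subgroup G)) : Set G :=
  ⋃ H ∈ S, (H : Set G)

/-- A kit is saturated if for every `a` and `α ∈ End a`, whenever for all `n`
either `α^n = 1` or some nontrivial power `α^(n*m)` lies in `⋃ K a`, then
`α ∈ ⋃ K a`. -/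
def Kit.Saturated {A : Type u} [Groupoid.{v} A] (K : Kit A) : Prop :=
  ∀ (a : A) (α : CategoryTheory.End a),
    (∀ n : ℕ, α ^ n = 1 ∨ ∃ m : ℕ, α ^ (n * m) ≠ 1 ∧ α ^ (n * m) ∈ unionOf (K.K a)) →
    α ∈ unionOf (K.K a)

theorem mem_unionOf_aux {G : Type*} [Group G] {S : Set (Subgroup G)} {x : G} :
    x ∈ unionOf S ↔ ∃ H ∈ S, x ∈ H := by
  simp [unionOf]

theorem zpow_natAbs_aux {G : Type*} [Group G] (x : G) (k : ℤ) :
    x ^ k = x ^ k.natAbs ∨ x ^ k = (x ^ k.natAbs)⁻¹ := by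
  rcases Int.natAbs_eq k with h | h
  · left
    conv_lhs => rw [h]
    exact zpow_natCast x _
  · right
    conv_lhs => rw [h]
    rw [zpow_neg, zpow_natCast]

theorem zpowers_inf_aux {G : Type*} [Group G] {x : G} {J : Subgroup G}
    (h : ∀ n : ℕ, x ^ n ∈ J → x ^ n = 1) : Subgroup.zpowers x ⊓ J = ⊥ := by
  rw [eq_bot_iff]
  rintro y ⟨hy, hJ⟩
  obtain ⟨k, rfl⟩ := Subgroup.mem_zpowers_iff.1 hy
  rw [Subgroup.mem_bot]
  have hJ' : x ^ k ∈ J := hJ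
  rcases zpow_natAbs_aux x k with e | e
  · rw [e] at hJ' ⊢
    exact h _ hJ'
  · rw [e] at hJ' ⊢
    rw [h _ (J.inv_mem_iff.1 hJ'), inv_one]

theorem eq_one_aux {G : Type*} [Group G] {H J : Subgroup G} (h : H ⊓ J = ⊥) {x : G}
    (hx : x ∈ H) (hy : x ∈ J) : x = 1 := by
  have : x ∈ H ⊓ J := ⟨hx, hy⟩
  rwa [h, Subgroup.mem_bot] at this

theorem group_aux {G : Type*} [Group G] (S : Set (Subgroup G)) :
    S = orthSet (orthSet S) ↔
    (S = {H : Subgroup G | (H : Set G) ⊆ unionOf S} ∧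
      ∀ α : G, (∀ n : ℕ, α ^ n = 1 ∨ ∃ m : ℕ, α ^ (n * m) ≠ 1 ∧ α ^ (n * m) ∈ unionOf S) →
        α ∈ unionOf S) := by
  constructor
  · intro hS
    refine ⟨?_, ?_⟩
    · apply Set.Subset.antisymm
      · intro H hH x hx
        exact mem_unionOf_aux.2 ⟨H, hH, hx⟩
      · intro H hH
        rw [hS]
        intro J hJ
        rw [eq_bot_iff]
        rintro x ⟨hx, hxJ⟩
        obtain ⟨H', hH', hx'⟩ := mem_unionOf_aux.1 (hH hx)
        exact Subgroup.mem_bot.2 (eq_one_aux (hJ H' hH') hxJ hx')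
    · intro α hα
      refine mem_unionOf_aux.2 ⟨Subgroup.zpowers α, ?_, Subgroup.mem_zpowers α⟩
      rw [hS]
      intro J hJ
      apply zpowers_inf_aux
      intro n hn
      rcases hα n with h | ⟨m, h1, h2⟩
      · exact h
      · obtain ⟨H', hH', hx'⟩ := mem_unionOf_aux.1 h2
        refine absurd (eq_one_aux (hJ H' hH') ?_ hx') h1
        rw [pow_mul]
        exact J.pow_mem hn m
  · rintro ⟨h1, h2⟩
    apply Set.Subset.antisymm
    · intro H hH J hJ
      rw [inf_comm]
      exact hJ H hH
    · intro H hH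
      rw [h1]
      intro x hx
      apply h2
      intro n
      by_contra hcon
      push Not at hcon
      obtain ⟨hn, hm⟩ := hcon
      apply hn
      refine eq_one_aux (hH (Subgroup.zpowers (x ^ n)) ?_) (H.pow_mem hx n)
        (Subgroup.mem_zpowers _)
      intro J hJ
      apply zpowers_inf_aux
      intro m hmJ
      rw [← pow_mul] at hmJ ⊢
      by_contra hne
      exact hm m hne (mem_unionOf_aux.2 ⟨J, hJ, hmJ⟩)

/-- A kit `K` satisfies `K = K^⊥⊥` iff (1) for every `a`, `K a`
consists exactly of the subgroups contained in `⋃ K a`, and (2) `K` is saturated. -/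
theorem booleanKit_characterisation {A : Type u} [Groupoid.{v} A] (K : Kit A) :
    (∀ a : A, K.K a = orthSet (orthSet (K.K a))) ↔
    ((∀ a : A, K.K a =
        {H : Subgroup (CategoryTheory.End a) | (H : Set (CategoryTheory.End a)) ⊆ unionOf (K.K a)}) ∧
      K.Saturated) := by
  constructor
  · intro h
    exact ⟨fun a => ((group_aux _).1 (h a)).1, fun a => ((group_aux _).1 (h a)).2⟩
  · rintro ⟨h1, h2⟩ a
    exact (group_aux _).2 ⟨h1 a, h2 a⟩
end

section
/- Let (𝔸, K₁) and (𝔹, K₂) be Boolean kits. Then for all objects a ∈ 𝔸 and b ∈ 𝔹, (K₁ ⊸ K₂)(a,b) = (K₁(a) × K₂^⊥(b))^⊥, i.e., the linear-arrow kit coincides pointwise with (K₁ ⊗ K₂^⊥)^⊥. -/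
open CategoryTheory

universe v u v₁ v₂ u₁ u₂

section Prod

variable {A : Type u₁} {B : Type u₂} [Groupoid.{v₁} A] [Groupoid.{v₂} B]

/-- First projection `End (a, b) →* End a` in a product groupoid. -/
def endFst (a : A) (b : B) :
    CategoryTheory.End ((a, b) : A × B) →* CategoryTheory.End a where
  toFun γ := γ.1
  map_one' := rfl
  map_mul' _ _ := rfl

/-- Second projection `End (a, b) →* End b` in a product groupoid. -/
def endSnd (a : A) (b : B) :
    CategoryTheory.End ((a, b) : A × B) →* CategoryTheory.End b where
  toFun γ := γ.2
  map_one' := rfl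
  map_mul' _ _ := rfl

/-- The product subgroup `G × H ≤ End (a, b) ≅ End a × End b`. -/
def prodSubgroup {a : A} {b : B} (G : Subgroup (CategoryTheory.End a))
    (H : Subgroup (CategoryTheory.End b)) :
    Subgroup (CategoryTheory.End ((a, b) : A × B)) :=
  (G.comap (endFst a b)) ⊓ (H.comap (endSnd a b))

/-- The set of product subgroups `G × H` with `G ∈ S` and `H ∈ T`. -/
def prodSet {a : A} {b : B} (S : Set (Subgroup (CategoryTheory.End a)))
    (T : Set (Subgroup (CategoryTheory.End b))) :
    Set (Subgroup (CategoryTheory.End ((a, b) : A × B))) :=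
  {P | ∃ G ∈ S, ∃ H ∈ T, P = prodSubgroup G H}

end Prod

/-- The linear-arrow set of subgroups `(S ⊸ T)(a,b)`: subgroups
`H ≤ End a × End b` such that for all `(α, β) ∈ H`, `α ∈ ⋃S → β ∈ ⋃T` and
`β ∈ ⋃T^⊥ → α ∈ ⋃S^⊥`. -/
def linArrowSet {A : Type u₁} {B : Type u₂} [Groupoid.{v₁} A] [Groupoid.{v₂} B]
    {a : A} {b : B} (S : Set (Subgroup (CategoryTheory.End a)))
    (T : Set (Subgroup (CategoryTheory.End b))) :
    Set (Subgroup (CategoryTheory.End ((a, b) : A × B))) :=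
  {H | ∀ γ ∈ H,
    (endFst a b γ ∈ unionOf S → endSnd a b γ ∈ unionOf T) ∧
    (endSnd a b γ ∈ unionOf (orthSet T) → endFst a b γ ∈ unionOf (orthSet S))}

/-- For Boolean kits `(A, K₁)` and `(B, K₂)` and objects `a, b`,
the linear-arrow kit coincides pointwise with `(K₁ ⊗ K₂^⊥)^⊥`:
`(K₁ ⊸ K₂)(a,b) = (K₁(a) × K₂^⊥(b))^⊥`. -/
theorem linArrow_eq_orth_prod {A : Type u₁} {B : Type u₂} [Groupoid.{v₁} A] [Groupoid.{v₂} B]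
    (K₁ : Kit A) (K₂ : Kit B) (h₁ : K₁.IsBoolean) (h₂ : K₂.IsBoolean) (a : A) (b : B) :
    linArrowSet (K₁.K a) (K₂.K b) = orthSet (prodSet (K₁.K a) (orthSet (K₂.K b))) := by
  ext H
  constructor
  · rintro hH P ⟨G, hG, J, hJ, rfl⟩
    rw [eq_bot_iff]
    rintro γ ⟨hγ, hγ1, hγ2⟩
    obtain ⟨p, q⟩ := hH γ hγ
    have hγ1' : endFst a b γ ∈ G := hγ1
    have hγ2' : endSnd a b γ ∈ J := hγ2
    have p' := p (Set.mem_biUnion hG hγ1')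
    have q' := q (Set.mem_biUnion hJ hγ2')
    obtain ⟨J', hJ', p''⟩ := Set.mem_iUnion₂.1 p'
    obtain ⟨G', hG', q''⟩ := Set.mem_iUnion₂.1 q'
    have e2 : endSnd a b γ ∈ (⊥ : Subgroup (CategoryTheory.End b)) := by
      rw [← hJ J' hJ']; exact ⟨hγ2', p''⟩
    have e1 : endFst a b γ ∈ (⊥ : Subgroup (CategoryTheory.End a)) := by
      rw [← hG' G hG]; exact ⟨q'', hγ1'⟩
    rw [Subgroup.mem_bot] at e1 e2 ⊢
    exact Prod.ext e1 e2
  · intro hH γ hγ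
    have key : ∀ G ∈ K₁.K a, ∀ J ∈ orthSet (K₂.K b), ∀ n : ℤ,
        (endFst a b γ) ^ n ∈ G → (endSnd a b γ) ^ n ∈ J →
        (endFst a b γ) ^ n = 1 ∧ (endSnd a b γ) ^ n = 1 := by
      intro G hG J hJ n m1 m2
      have hm : γ ^ n ∈ H ⊓ prodSubgroup G J := by
        refine ⟨H.zpow_mem hγ n, ?_, ?_⟩
        · show endFst a b (γ ^ n) ∈ G
          rwa [map_zpow]
        · show endSnd a b (γ ^ n) ∈ J
          rwa [map_zpow]
      rw [hH _ ⟨G, hG, J, hJ, rfl⟩, Subgroup.mem_bot] at hm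
      rw [← map_zpow, ← map_zpow, hm, map_one, map_one]
      exact ⟨rfl, rfl⟩
    constructor
    · intro h
      obtain ⟨G, hG, hg⟩ := Set.mem_iUnion₂.1 h
      rw [h₂ b]
      refine Set.mem_biUnion (x := Subgroup.zpowers (endSnd a b γ)) ?_
        (Subgroup.mem_zpowers _)
      intro J hJ
      rw [eq_bot_iff]
      rintro x ⟨⟨n, rfl⟩, hx⟩
      exact Subgroup.mem_bot.2 (key G hG J hJ n (G.zpow_mem hg n) hx).2
    · intro h
      obtain ⟨J, hJ, hj⟩ := Set.mem_iUnion₂.1 h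
      refine Set.mem_biUnion (x := Subgroup.zpowers (endFst a b γ)) ?_
        (Subgroup.mem_zpowers _)
      intro G hG
      rw [eq_bot_iff]
      rintro x ⟨⟨n, rfl⟩, hx⟩
      exact Subgroup.mem_bot.2 (key G hG J hJ n hx (J.zpow_mem hj n)).1
end

section
/- Let (𝔸, K₁) and (𝔹, K₂) be Boolean kits, a ∈ 𝔸, b ∈ 𝔹, and suppose (α, β) ∈ ⋃(K₁(a) × K₂(b))^⊥, i.e., (α,β) belongs to some subgroup of End(a) × End(b) orthogonal to every product subgroup G × H with G ∈ K₁(a), H ∈ K₂(b). Then α ∈ ⋃K₁(a) implies β ∈ ⋃K₂(b)^⊥, and β ∈ ⋃K₂(b) implies α ∈ ⋃K₁(a)^⊥. -/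
open CategoryTheory

universe v u v₁ v₂ u₁ u₂

/-- For Boolean kits `(A, K₁)` and `(B, K₂)`, objects `a, b`, and
`(α, β)` in the union of `(K₁(a) × K₂(b))^⊥`: if `α ∈ ⋃K₁(a)` then
`β ∈ ⋃K₂(b)^⊥`, and if `β ∈ ⋃K₂(b)` then `α ∈ ⋃K₁(a)^⊥`. -/
theorem tensor_orth_arrow {A : Type u₁} {B : Type u₂} [Groupoid.{v₁} A] [Groupoid.{v₂} B]
    (K₁ : Kit A) (K₂ : Kit B) (h₁ : K₁.IsBoolean) (h₂ : K₂.IsBoolean)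
    (a : A) (b : B) (γ : CategoryTheory.End ((a, b) : A × B))
    (hγ : γ ∈ unionOf (orthSet (prodSet (K₁.K a) (K₂.K b)))) :
    (endFst a b γ ∈ unionOf (K₁.K a) → endSnd a b γ ∈ unionOf (orthSet (K₂.K b))) ∧
    (endSnd a b γ ∈ unionOf (K₂.K b) → endFst a b γ ∈ unionOf (orthSet (K₁.K a))) := by
  simp only [unionOf, Set.mem_iUnion, SetLike.mem_coe, exists_prop] at hγ ⊢
  obtain ⟨D, hD, hγD⟩ := hγ
  constructor
  · rintro ⟨G, hG, hαG⟩
    refine ⟨Subgroup.zpowers (endSnd a b γ), ?_, Subgroup.mem_zpowers _⟩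
    intro H hH
    rw [eq_bot_iff]
    rintro x ⟨⟨n, rfl⟩, hx⟩
    have hx' : endSnd a b γ ^ n ∈ H := hx
    have key : γ ^ n ∈ D ⊓ prodSubgroup G H := by
      refine ⟨D.zpow_mem hγD n, ?_, ?_⟩
      · show endFst a b (γ ^ n) ∈ G
        rw [map_zpow]
        exact G.zpow_mem hαG n
      · show endSnd a b (γ ^ n) ∈ H
        rw [map_zpow]
        exact hx'
    rw [hD _ ⟨G, hG, H, hH, rfl⟩, Subgroup.mem_bot] at key
    show endSnd a b γ ^ n = 1
    rw [← map_zpow, key, map_one]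
  · rintro ⟨H, hH, hβH⟩
    refine ⟨Subgroup.zpowers (endFst a b γ), ?_, Subgroup.mem_zpowers _⟩
    intro G hG
    rw [eq_bot_iff]
    rintro x ⟨⟨n, rfl⟩, hx⟩
    have hx' : endFst a b γ ^ n ∈ G := hx
    have key : γ ^ n ∈ D ⊓ prodSubgroup G H := by
      refine ⟨D.zpow_mem hγD n, ?_, ?_⟩
      · show endFst a b (γ ^ n) ∈ G
        rw [map_zpow]
        exact hx'
      · show endSnd a b (γ ^ n) ∈ H
        rw [map_zpow]
        exact H.zpow_mem hβH n
    rw [hD _ ⟨G, hG, H, hH, rfl⟩, Subgroup.mem_bot] at key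
    show endFst a b γ ^ n = 1
    rw [← map_zpow, key, map_one]
end

section
/- Let (𝔸, K₁), (𝔹, K₂), (ℂ, K₃) be Boolean kits and let a ∈ 𝔸, b ∈ 𝔹, c ∈ ℂ. Then, as sets of subgroups of End(a) × End(b) × End(c): ((K₁(a) × K₂(b))^⊥⊥ × K₃^⊥(c))^⊥ = ((K₁(a) × K₂(b)) × K₃^⊥(c))^⊥, and (K₁(a) × (K₂(b) × K₃^⊥(c))^⊥⊥)^⊥ = (K₁(a) × (K₂(b) × K₃^⊥(c)))^⊥. -/
open CategoryTheory

universe v u v₁ v₂ u₁ u₂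

universe v₃ u₃

theorem le_biorth {G : Type*} [Group G] (S : Set (Subgroup G)) : S ⊆ orthSet (orthSet S) := by
  intro H hH J hJ
  rw [inf_comm]
  exact hJ H hH

theorem bot_mem_orth {G : Type*} [Group G] (S : Set (Subgroup G)) : ⊥ ∈ orthSet S := by
  intro J _
  exact bot_inf_eq J

/-- A nontrivial element of a member of the biorthogonal has a nontrivial power in a member. -/
theorem exists_pow_of_biorth {G : Type*} [Group G] {S : Set (Subgroup G)} {J : Subgroup G}
    (hJ : J ∈ orthSet (orthSet S)) {g : G} (hg : g ∈ J) (hne : g ≠ 1) :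
    ∃ n : ℤ, g ^ n ≠ 1 ∧ ∃ H ∈ S, g ^ n ∈ H := by
  by_contra hcon
  apply hne
  have hz : Subgroup.zpowers g ∈ orthSet S := by
    intro H hH
    rw [eq_bot_iff]
    rintro x ⟨⟨n, rfl⟩, hx⟩
    by_contra hx1
    exact hcon ⟨n, fun h => hx1 (Subgroup.mem_bot.2 h), H, hH, hx⟩
  have h2 : g ∈ J ⊓ Subgroup.zpowers g := ⟨hg, Subgroup.mem_zpowers g⟩
  rw [hJ _ hz] at h2
  exact Subgroup.mem_bot.1 h2

theorem orth_prod_left {A : Type u₁} {B : Type u₂} [Groupoid.{v₁} A] [Groupoid.{v₂} B]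
    {a : A} {b : B} (S : Set (Subgroup (CategoryTheory.End a)))
    (T : Set (Subgroup (CategoryTheory.End b))) (hS : S.Nonempty) :
    orthSet (prodSet (orthSet (orthSet S)) T) = orthSet (prodSet S T) := by
  apply Set.Subset.antisymm
  · rintro P hP _ ⟨G, hG, H, hH, rfl⟩
    exact hP _ ⟨G, le_biorth S hG, H, hH, rfl⟩
  · rintro P hP _ ⟨G, hG, H, hH, rfl⟩
    rw [eq_bot_iff]
    rintro x ⟨hxP, hx1, hx2⟩
    have key : endFst a b x = 1 := by
      by_contra hne
      obtain ⟨n, hn, G', hG', hm⟩ := exists_pow_of_biorth hG hx1 hne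
      apply hn
      have h2 : x ^ n ∈ P ⊓ prodSubgroup G' H := by
        refine ⟨P.zpow_mem hxP n, ?_, Subgroup.zpow_mem _ hx2 n⟩
        change endFst a b (x ^ n) ∈ G'
        rw [map_zpow]; exact hm
      rw [hP _ ⟨G', hG', H, hH, rfl⟩] at h2
      rw [← map_zpow, Subgroup.mem_bot.1 h2, map_one]
    obtain ⟨G', hG'⟩ := hS
    have h2 : x ∈ P ⊓ prodSubgroup G' H := by
      refine ⟨hxP, ?_, hx2⟩
      change endFst a b x ∈ G'
      rw [key]; exact G'.one_mem
    rwa [hP _ ⟨G', hG', H, hH, rfl⟩] at h2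

theorem orth_prod_right {A : Type u₁} {B : Type u₂} [Groupoid.{v₁} A] [Groupoid.{v₂} B]
    {a : A} {b : B} (S : Set (Subgroup (CategoryTheory.End a)))
    (T : Set (Subgroup (CategoryTheory.End b))) (hT : T.Nonempty) :
    orthSet (prodSet S (orthSet (orthSet T))) = orthSet (prodSet S T) := by
  apply Set.Subset.antisymm
  · rintro P hP _ ⟨G, hG, H, hH, rfl⟩
    exact hP _ ⟨G, hG, H, le_biorth T hH, rfl⟩
  · rintro P hP _ ⟨G, hG, H, hH, rfl⟩
    rw [eq_bot_iff]
    rintro x ⟨hxP, hx1, hx2⟩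
    have key : endSnd a b x = 1 := by
      by_contra hne
      obtain ⟨n, hn, H', hH', hm⟩ := exists_pow_of_biorth hH hx2 hne
      apply hn
      have h2 : x ^ n ∈ P ⊓ prodSubgroup G H' := by
        refine ⟨P.zpow_mem hxP n, Subgroup.zpow_mem _ hx1 n, ?_⟩
        change endSnd a b (x ^ n) ∈ H'
        rw [map_zpow]; exact hm
      rw [hP _ ⟨G, hG, H', hH', rfl⟩] at h2
      rw [← map_zpow, Subgroup.mem_bot.1 h2, map_one]
    obtain ⟨H', hH'⟩ := hT
    have h2 : x ∈ P ⊓ prodSubgroup G H' := by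
      refine ⟨hxP, hx1, ?_⟩
      change endSnd a b x ∈ H'
      rw [key]; exact H'.one_mem
    rwa [hP _ ⟨G, hG, H', hH', rfl⟩] at h2

theorem Kit.IsBoolean.bot_mem {A : Type u} [Groupoid.{v} A] {K : Kit A} (h : K.IsBoolean)
    (a : A) : ⊥ ∈ K.K a := by
  rw [h a]
  exact bot_mem_orth _

/-- associativity-preparation lemma.  For Boolean kits `(A, K₁)`,
`(B, K₂)`, `(C, K₃)` and objects `a, b, c`:
`((K₁(a) × K₂(b))^⊥⊥ × K₃^⊥(c))^⊥ = ((K₁(a) × K₂(b)) × K₃^⊥(c))^⊥` and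
`(K₁(a) × (K₂(b) × K₃^⊥(c))^⊥⊥)^⊥ = (K₁(a) × (K₂(b) × K₃^⊥(c)))^⊥`. -/
theorem assoc_tensor_step {A : Type u₁} {B : Type u₂} {C : Type u₃}
    [Groupoid.{v₁} A] [Groupoid.{v₂} B] [Groupoid.{v₃} C]
    (K₁ : Kit A) (K₂ : Kit B) (K₃ : Kit C)
    (h₁ : K₁.IsBoolean) (h₂ : K₂.IsBoolean) (h₃ : K₃.IsBoolean)
    (a : A) (b : B) (c : C) :
    orthSet (prodSet (orthSet (orthSet (prodSet (K₁.K a) (K₂.K b)))) (orthSet (K₃.K c)))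
      = orthSet (prodSet (prodSet (K₁.K a) (K₂.K b)) (orthSet (K₃.K c))) ∧
    orthSet (prodSet (K₁.K a) (orthSet (orthSet (prodSet (K₂.K b) (orthSet (K₃.K c))))))
      = orthSet (prodSet (K₁.K a) (prodSet (K₂.K b) (orthSet (K₃.K c)))) := by
  exact ⟨orth_prod_left _ _ ⟨_, ⊥, h₁.bot_mem a, ⊥, h₂.bot_mem b, rfl⟩,
    orth_prod_right _ _ ⟨_, ⊥, h₂.bot_mem b, ⊥, bot_mem_orth _, rfl⟩⟩
end

section
/- Let 𝔸 be a groupoid and C a full subcategory (equivalently, a collection) of presheaves 𝔸ᵒᵖ ⥤ Set. Then the family Stab(C) defined by Stab(C)(a) = {G ≤ End(a) | ∃ X ∈ C, ∃ x ∈ X(a), G = Stab(x)} is a kit on 𝔸 (closed under conjugation). Moreover, for any kit K on 𝔸: Stab(StPSh(𝔸,K)) = K, and C ⊆ StPSh(𝔸, Stab(C)). -/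
open CategoryTheory

universe v u

section PresheafStab

variable {A : Type u} [Groupoid.{v} A]

/-- The stabilizer subgroup of an element `x ∈ X(a)` of a presheaf on a groupoid. -/
def presheafStab (X : Aᵒᵖ ⥤ Type v) (a : A) (x : X.obj (Opposite.op a)) :
    Subgroup (CategoryTheory.End a) where
  carrier := {α | X.map ((α : a ⟶ a)).op x = x}
  one_mem' := by
    show X.map ((𝟙 a : a ⟶ a)).op x = x
    simp
  mul_mem' := by
    intro α β hα hβ
    show X.map ((β ≫ α : a ⟶ a)).op x = x
    rw [CategoryTheory.op_comp, X.map_comp]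
    simp only [types_comp_apply]
    rw [hα, hβ]
  inv_mem' := by
    intro α hα
    show X.map ((Groupoid.inv α : a ⟶ a)).op x = x
    conv_lhs => rw [← hα]
    rw [← types_comp_apply (X.map _) (X.map _), ← X.map_comp, ← CategoryTheory.op_comp]
    have : (Groupoid.inv α ≫ α : a ⟶ a) = 𝟙 a := Groupoid.inv_comp α
    rw [this]
    simp

end PresheafStab

variable {A : Type u} [Groupoid.{v} A]

/-- The family of stabilizer subgroups arising from a collection of presheaves. -/
def stabFamily (C : Set (Aᵒᵖ ⥤ Type v)) (a : A) : Set (Subgroup (CategoryTheory.End a)) :=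
  {G | ∃ X ∈ C, ∃ x : X.obj (Opposite.op a), G = presheafStab X a x}

/-- The collection of `K`-stabilized presheaves: those all of whose elements have
stabilizer in `K`. -/
def StPSh (K : ∀ a : A, Set (Subgroup (CategoryTheory.End a))) : Set (Aᵒᵖ ⥤ Type v) :=
  {X | ∀ (a : A) (x : X.obj (Opposite.op a)), presheafStab X a x ∈ K a}

theorem mem_presheafStab (X : Aᵒᵖ ⥤ Type v) (a : A) (x : X.obj (Opposite.op a))
    (g : CategoryTheory.End a) :
    g ∈ presheafStab X a x ↔ X.map (Quiver.Hom.op (g : a ⟶ a)) x = x := Iff.rfl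

theorem mem_conjSub {a a' : A} (α : a' ⟶ a) (G : Subgroup (CategoryTheory.End a))
    (h : CategoryTheory.End a') :
    h ∈ conjSub α G ↔ ∃ g : CategoryTheory.End a, g ∈ G ∧
      (α ≫ (g : a ⟶ a) ≫ Groupoid.inv α : a' ⟶ a') = h := Iff.rfl

theorem conjSub_stab (X : Aᵒᵖ ⥤ Type v) {a a' : A} (α : a' ⟶ a) (x : X.obj (Opposite.op a)) :
    conjSub α (presheafStab X a x) = presheafStab X a' (X.map α.op x) := by
  ext h
  rw [mem_conjSub, mem_presheafStab]
  constructor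
  · rintro ⟨g, hg, rfl⟩
    rw [mem_presheafStab] at hg
    rw [← types_comp_apply (X.map _) (X.map _), ← X.map_comp, ← op_comp]
    have e : (α ≫ (g : a ⟶ a) ≫ Groupoid.inv α) ≫ α = α ≫ (g : a ⟶ a) := by simp
    rw [e, op_comp, X.map_comp, types_comp_apply, hg]
  · intro hh
    refine ⟨(Groupoid.inv α ≫ (h : a' ⟶ a') ≫ α : a ⟶ a), ?_, by simp⟩
    rw [mem_presheafStab, op_comp, op_comp, X.map_comp, X.map_comp, types_comp_apply,
      types_comp_apply, hh, ← types_comp_apply (X.map _) (X.map _), ← X.map_comp, ← op_comp]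
    simp

/-- Two arrows into `a` are identified when they differ by an element of `G`. -/
def orbSetoid {a : A} (G : Subgroup (CategoryTheory.End a)) (b : A) : Setoid (b ⟶ a) where
  r f f' := ∃ g : CategoryTheory.End a, g ∈ G ∧ f ≫ (g : a ⟶ a) = f'
  iseqv :=
    { refl := fun f => ⟨1, G.one_mem, Category.comp_id f⟩
      symm := by
        rintro f f' ⟨g, hg, rfl⟩
        refine ⟨g⁻¹, G.inv_mem hg, ?_⟩
        show (f ≫ (g : a ⟶ a)) ≫ Groupoid.inv (g : a ⟶ a) = f
        simp
      trans := by
        rintro f f' f'' ⟨g, hg, rfl⟩ ⟨k, hk, rfl⟩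
        refine ⟨k * g, G.mul_mem hk hg, ?_⟩
        show f ≫ ((g : a ⟶ a) ≫ (k : a ⟶ a)) = _
        simp }

/-- The quotient of the representable presheaf at `a` by `G`. -/
def orbPsh {a : A} (G : Subgroup (CategoryTheory.End a)) : Aᵒᵖ ⥤ Type v where
  obj b := Quotient (orbSetoid G b.unop)
  map {b c} k := TypeCat.ofHom (Quotient.map (fun f => k.unop ≫ f) (by
    rintro f f' ⟨g, hg, rfl⟩
    exact ⟨g, hg, by simp⟩))
  map_id b := by
    ext x
    induction x using Quotient.inductionOn with
    | h f => simp
  map_comp k l := by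
    ext x
    induction x using Quotient.inductionOn with
    | h f => simp

theorem orbPsh_stab {a : A} (G : Subgroup (CategoryTheory.End a)) {b : A} (f : b ⟶ a) :
    presheafStab (orbPsh G) b (Quotient.mk (orbSetoid G b) f) = conjSub f G := by
  ext h
  rw [mem_conjSub]
  have e : h ∈ presheafStab (orbPsh G) b (Quotient.mk (orbSetoid G b) f) ↔
    Quotient.mk (orbSetoid G b) ((h : b ⟶ b) ≫ f) = Quotient.mk (orbSetoid G b) f := Iff.rfl
  refine e.trans (eq_comm.trans ((Quotient.eq (r := orbSetoid G b)).trans ?_))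
  constructor
  · rintro ⟨g, hg, hh⟩
    refine ⟨g, hg, ?_⟩
    rw [← Category.assoc, hh]
    simp
  · rintro ⟨g, hg, rfl⟩
    exact ⟨g, hg, by simp⟩

theorem conjSub_id {a : A} (G : Subgroup (CategoryTheory.End a)) : conjSub (𝟙 a) G = G := by
  ext h
  rw [mem_conjSub]
  constructor
  · rintro ⟨g, hg, rfl⟩
    have : (𝟙 a ≫ (g : a ⟶ a) ≫ Groupoid.inv (𝟙 a) : a ⟶ a) = g := by
      simp [Groupoid.inv_eq_inv]
    rw [this]
    exact hg
  · intro hh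
    exact ⟨h, hh, by simp [Groupoid.inv_eq_inv]⟩

/-- For any collection `C` of presheaves on a groupoid `A`, the family
`Stab(C)` of stabilizers of elements of members of `C` is a kit (closed under
conjugation); moreover `Stab(StPSh(A,K)) = K` for every kit `K`, and
`C ⊆ StPSh(A, Stab(C))`. -/
theorem stabFamily_kit (C : Set (Aᵒᵖ ⥤ Type v)) :
    (∀ {a a' : A} (α : a' ⟶ a), ∀ G ∈ stabFamily C a, conjSub α G ∈ stabFamily C a') ∧
    (∀ (K : Kit A) (a : A), stabFamily (StPSh K.K) a = K.K a) ∧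
    C ⊆ StPSh (stabFamily C) := by
  refine ⟨?_, ?_, ?_⟩
  · rintro a a' α G ⟨X, hX, x, rfl⟩
    exact ⟨X, hX, X.map α.op x, conjSub_stab X α x⟩
  · intro K a
    ext G
    constructor
    · rintro ⟨X, hX, x, rfl⟩
      exact hX a x
    · intro hG
      refine ⟨orbPsh G, ?_, Quotient.mk (orbSetoid G a) (𝟙 a), ?_⟩
      · intro b x
        obtain ⟨f, rfl⟩ := Quotient.exists_rep x
        exact (orbPsh_stab G f).symm ▸ K.conj_mem f G hG
      · rw [orbPsh_stab, conjSub_id]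
  · intro X hX a x
    exact ⟨X, hX, x, rfl⟩
end

section
/- Let (A, ≤_A) and (B, ≤_B) be partial orders and f : A → B a Scott-continuous (in particular monotone) function. Then f is stable — meaning that for every x ∈ A and y ∈ B with y ≤_B f(x), there exists a unique minimal x₀ ∈ A with x₀ ≤_A x and y ≤_B f(x₀) (i.e., x₀ ≤_A x, y ≤_B f(x₀), and for every x' ≤_A x with y ≤_B f(x'), x₀ ≤_A x') — if and only if for every x ∈ A, the restriction f_x : {x' | x' ≤_A x} → {y | y ≤_B f(x)} of f to principal downsets has a (monotone) left adjoint, i.e., there is a monotone m : {y ≤_B f(x)} → {x' ≤_A x} with m(y) ≤_A x' ⟺ y ≤_B f(x') for all y ≤_B f(x) and x' ≤_A x. -/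
/-- A Scott-continuous map between partial orders is stable (every
`y ≤ f x` has a unique minimal `x₀ ≤ x` with `y ≤ f x₀`) iff each restriction
to principal downsets `{x' | x' ≤ x} → {y | y ≤ f x}` has a monotone left adjoint. -/
theorem stable_iff_local_left_adjoint {A B : Type*} [PartialOrder A] [PartialOrder B]
    (f : A → B) (hf : ScottContinuous f) :
    (∀ (x : A) (y : B), y ≤ f x →
      ∃! x₀ : A, x₀ ≤ x ∧ y ≤ f x₀ ∧ ∀ x' : A, x' ≤ x → y ≤ f x' → x₀ ≤ x') ↔
    (∀ x : A, ∃ m : {y : B // y ≤ f x} → {x' : A // x' ≤ x},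
      Monotone m ∧ ∀ (y : {y : B // y ≤ f x}) (x' : {x' : A // x' ≤ x}),
        m y ≤ x' ↔ (y : B) ≤ f (x' : A)) := by
  have hmono : Monotone f := hf.monotone
  constructor
  · intro h x
    choose g hg _ using fun y : {y : B // y ≤ f x} => h x y.1 y.2
    refine ⟨fun y => ⟨g y, (hg y).1⟩, ?_, ?_⟩
    · intro y z hyz
      exact (hg y).2.2 (g z) (hg z).1 (le_trans hyz (hg z).2.1)
    · intro y x'
      constructor
      · intro hle
        exact le_trans (hg y).2.1 (hmono hle)
      · intro hle
        exact (hg y).2.2 x'.1 x'.2 hle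
  · intro h x y hy
    obtain ⟨m, _, hm⟩ := h x
    have h1 : y ≤ f (m ⟨y, hy⟩).1 := (hm ⟨y, hy⟩ (m ⟨y, hy⟩)).1 le_rfl
    refine ⟨(m ⟨y, hy⟩).1, ⟨(m ⟨y, hy⟩).2, h1, ?_⟩, ?_⟩
    · intro x' hx' hyx'
      exact (hm ⟨y, hy⟩ ⟨x', hx'⟩).2 hyx'
    · rintro z ⟨hz, hyz, hmin⟩
      exact le_antisymm (hmin _ (m ⟨y, hy⟩).2 h1) ((hm ⟨y, hy⟩ ⟨z, hz⟩).2 hyz)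
end

section
/- Let T : 𝔸 ⥤ 𝔹 be a functor between categories. Then T is a local right adjoint (i.e., for every object a of 𝔸 the induced functor T_a : 𝔸/a ⥤ 𝔹/T(a) between slice categories is a right adjoint) if and only if T admits generic factorizations, i.e., every morphism h : b ⟶ T(a) in 𝔹 factors as h = T(f) ∘ g for some g : b ⟶ T(a₀) generic and f : a₀ ⟶ a. -/
open CategoryTheory

universe v₁ v₂ u₁ u₂

/-- A morphism `g : b ⟶ T a` is generic for a functor `T` if every commuting square
`g ≫ T h = v ≫ T f` admits a unique diagonal filler `k` with `k ≫ f = h` and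
`g ≫ T k = v`. -/
def IsGeneric {A : Type u₁} {B : Type u₂} [Category.{v₁} A] [Category.{v₂} B]
    (T : A ⥤ B) {a : A} {b : B} (g : b ⟶ T.obj a) : Prop :=
  ∀ {a' a'' : A} (h : a ⟶ a'') (f : a' ⟶ a'') (v : b ⟶ T.obj a'),
    g ≫ T.map h = v ≫ T.map f →
    ∃! k : a ⟶ a', k ≫ f = h ∧ g ≫ T.map k = v

/-- `T` admits generic factorizations relative to the object `b`: every morphism
`b ⟶ T a` factors as a generic morphism followed by the image of a morphism of `A`. -/
def AdmitsGenericFactorizationsAt {A : Type u₁} {B : Type u₂} [Category.{v₁} A]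
    [Category.{v₂} B] (T : A ⥤ B) (b : B) : Prop :=
  ∀ (a : A) (h : b ⟶ T.obj a), ∃ (a₀ : A) (g : b ⟶ T.obj a₀) (f : a₀ ⟶ a),
    IsGeneric T g ∧ g ≫ T.map f = h

/-- The elementary form of the slice functor at `a` having a left adjoint. -/
def LocalUnit {A : Type u₁} {B : Type u₂} [Category.{v₁} A] [Category.{v₂} B]
    (T : A ⥤ B) {a a₀ : A} {b : B} (g : b ⟶ T.obj a₀) (f₀ : a₀ ⟶ a) : Prop :=
  ∀ {a' : A} (f : a' ⟶ a) (v : b ⟶ T.obj a'), g ≫ T.map f₀ = v ≫ T.map f →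
    ∃! k : a₀ ⟶ a', k ≫ f = f₀ ∧ g ≫ T.map k = v

theorem exists_localUnit {A : Type u₁} {B : Type u₂} [Category.{v₁} A] [Category.{v₂} B]
    (T : A ⥤ B) (a : A) (H : (Over.post T : Over a ⥤ Over (T.obj a)).IsRightAdjoint)
    {b : B} (h : b ⟶ T.obj a) :
    ∃ (a₀ : A) (g : b ⟶ T.obj a₀) (f : a₀ ⟶ a), g ≫ T.map f = h ∧ LocalUnit T g f := by
  obtain ⟨L, ⟨adj⟩⟩ := H.exists_leftAdjoint
  let X : Over (T.obj a) := Over.mk h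
  have hw : (adj.unit.app X).left ≫ T.map (L.obj X).hom = h := Over.w (adj.unit.app X)
  refine ⟨(L.obj X).left, (adj.unit.app X).left, (L.obj X).hom, hw, ?_⟩
  intro a' f v hv
  let φ : X ⟶ (Over.post T).obj (Over.mk f) := Over.homMk v (by
    change v ≫ T.map f = h
    exact hv.symm.trans hw)
  refine ⟨((adj.homEquiv X (Over.mk f)).symm φ).left, ⟨Over.w ((adj.homEquiv X (Over.mk f)).symm φ), ?_⟩, ?_⟩
  · have := (adj.homEquiv X (Over.mk f)).apply_symm_apply φ
    rw [Adjunction.homEquiv_unit] at this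
    exact congrArg (fun t => t.left) this
  · rintro k ⟨hk, hk'⟩
    let κ : L.obj X ⟶ Over.mk f := Over.homMk k hk
    have : (adj.homEquiv X (Over.mk f)).symm φ = κ := by
      rw [Equiv.symm_apply_eq, Adjunction.homEquiv_unit]
      apply Over.OverMorphism.ext
      exact hk'.symm
    rw [this]
    rfl

/-- A functor `T : A ⥤ B` is a local right adjoint (every induced slice
functor `A/a ⥤ B/T a` is a right adjoint) iff it admits generic factorizations. -/
theorem localRightAdjoint_iff_genericFactorizations {A : Type u₁} {B : Type u₂}
    [Category.{v₁} A] [Category.{v₂} B] (T : A ⥤ B) :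
    (∀ a : A, (Over.post T : Over a ⥤ Over (T.obj a)).IsRightAdjoint) ↔
    (∀ b : B, AdmitsGenericFactorizationsAt T b) := by
  constructor
  · intro H b a h
    obtain ⟨a₀, g, f₀, hg, hu⟩ := exists_localUnit T a (H a) h
    refine ⟨a₀, g, f₀, ?_, hg⟩
    intro a' a'' p f v hv
    obtain ⟨a₁, g₁, f₁, hg₁, hu₁⟩ := exists_localUnit T a'' (H a'') (g ≫ T.map p)
    obtain ⟨k, ⟨hk, hk'⟩, -⟩ := hu₁ p g hg₁
    obtain ⟨l, ⟨hl, hl'⟩, -⟩ := hu (k ≫ f₀) g₁ (by rw [T.map_comp, ← Category.assoc, hk'])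
    have hlk : l ≫ k = 𝟙 a₀ := (hu f₀ g rfl).unique
      ⟨by rw [Category.assoc, hl], by rw [T.map_comp, ← Category.assoc, hl', hk']⟩
      ⟨by simp, by simp⟩
    obtain ⟨m, ⟨hm, hm'⟩, hmu⟩ := hu₁ f v (hg₁.trans hv)
    refine ⟨l ≫ m, ⟨?_, ?_⟩, ?_⟩
    · rw [Category.assoc, hm, ← hk, ← Category.assoc, hlk, Category.id_comp]
    · rw [T.map_comp, ← Category.assoc, hl', hm']
    · rintro n ⟨hn, hn'⟩
      have := hmu (k ≫ n) ⟨by rw [Category.assoc, hn, hk],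
        by rw [T.map_comp, ← Category.assoc, hk', hn']⟩
      rw [← this, ← Category.assoc, hlk, Category.id_comp]
  · intro H a
    rw [isRightAdjoint_iff_hasInitial_structuredArrow]
    intro X
    obtain ⟨a₀, g, f₀, hgen, hg⟩ := H X.left a X.hom
    let I : StructuredArrow X (Over.post T : Over a ⥤ Over (T.obj a)) :=
      StructuredArrow.mk (Y := Over.mk f₀) (Over.homMk g hg)
    have key : ∀ Y : StructuredArrow X (Over.post T : Over a ⥤ Over (T.obj a)),
        Nonempty (Unique (I ⟶ Y)) := by
      intro Y
      have hY : Y.hom.left ≫ T.map Y.right.hom = X.hom := Over.w Y.hom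
      obtain ⟨k, ⟨hk, hk'⟩, hu⟩ := hgen f₀ Y.right.hom Y.hom.left (hg.trans hY.symm)
      refine ⟨⟨⟨StructuredArrow.homMk (Over.homMk k hk) ?_⟩, ?_⟩⟩
      · apply Over.OverMorphism.ext
        exact hk'
      · intro t
        apply StructuredArrow.hom_ext
        apply Over.OverMorphism.ext
        exact hu t.right.left ⟨Over.w t.right,
          congrArg (fun s => s.left) (StructuredArrow.w t)⟩
    have := fun Y => (key Y).some
    exact Limits.hasInitial_of_unique I
end
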